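/- Let 𝒢 = {G_1,…,G_g} be a partition of 𝒩 = {1,…,n} with l_min ≤ |G_j| ≤ k for all j, set s_max = ⌊k/l_min⌋, and let ‖z‖_GL := Σ_{j=1}^g ‖z_{G_j}‖₂ be the group LASSO norm. Suppose A ∈ ℝ^{m×n} satisfies GRIP of order 2k with constant δ = δ_{2k} satisfying δ < 1/(1 + √(2·s_max)). Let x ∈ ℝ^n, y = Ax + η with ‖η‖₂ ≤ ε, and let x̂ minimize ‖z‖_GL over all z with ‖y − Az‖₂ ≤ ε. Then ‖x̂ − x‖₂ ≤ 2·(1 + (√2−1)δ)/(1 − (1 + √(2·s_max))δ)·σ_{k,𝒢}(x,‖·‖_GL) + 2(1 + √s_max)·√(1+δ)/(1 − (1 + √(2·s_max))δ)·ε. -/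

import Mathlib

noncomputable section

open Finset

/-- The restriction `x_Λ` of `x : ℝ^n` to the coordinates in `Λ` (zero outside `Λ`). -/
def restr {n : ℕ} (Λ : Finset (Fin n)) (x : Fin n → ℝ) : Fin n → ℝ :=
  fun i => if i ∈ Λ then x i else 0

/-- The Euclidean norm on `ℝ^n`. -/
def norm2 {n : ℕ} (x : Fin n → ℝ) : ℝ := Real.sqrt (∑ i, (x i) ^ 2)

/-- `Λ` is a group `t`-sparse set: a union of groups of the partition `G`, of cardinality `≤ t`. -/
def GkS {n g : ℕ} (G : Fin g → Finset (Fin n)) (t : ℕ) (Λ : Finset (Fin n)) : Prop :=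
  (∃ S : Finset (Fin g), Λ = S.biUnion G) ∧ Λ.card ≤ t

/-- `A` satisfies the group restricted isometry property of order `t` with constant `δ`. -/
def GRIP {m n g : ℕ} (G : Fin g → Finset (Fin n)) (A : Matrix (Fin m) (Fin n) ℝ)
    (t : ℕ) (δ : ℝ) : Prop :=
  ∀ z : Fin n → ℝ, (∃ Λ : Finset (Fin n), GkS G t Λ ∧ Function.support z ⊆ ↑Λ) →
    (1 - δ) * (norm2 z) ^ 2 ≤ (norm2 (A.mulVec z)) ^ 2 ∧
    (norm2 (A.mulVec z)) ^ 2 ≤ (1 + δ) * (norm2 z) ^ 2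

theorem norm2_eq {n : ℕ} (x : Fin n → ℝ) : norm2 x = ‖WithLp.toLp 2 x‖ := by
  simp [norm2, EuclideanSpace.norm_eq]

theorem norm2_nonneg {n : ℕ} (x : Fin n → ℝ) : 0 ≤ norm2 x := Real.sqrt_nonneg _

theorem norm2_sq {n : ℕ} (x : Fin n → ℝ) : norm2 x ^ 2 = x ⬝ᵥ x := by
  rw [norm2, Real.sq_sqrt (Finset.sum_nonneg fun i _ => sq_nonneg _)]
  simp [dotProduct, sq]

theorem norm2_add_le {n : ℕ} (x y : Fin n → ℝ) : norm2 (x + y) ≤ norm2 x + norm2 y := by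
  simpa [norm2_eq] using norm_add_le (WithLp.toLp 2 x) (WithLp.toLp 2 y)

theorem norm2_sub_le {n : ℕ} (x y : Fin n → ℝ) : norm2 (x - y) ≤ norm2 x + norm2 y := by
  simpa [norm2_eq] using norm_sub_le (WithLp.toLp 2 x) (WithLp.toLp 2 y)

theorem norm2_sum_le {ι : Type*} {n : ℕ} (s : Finset ι) (f : ι → Fin n → ℝ) :
    norm2 (∑ i ∈ s, f i) ≤ ∑ i ∈ s, norm2 (f i) := by
  simpa [norm2_eq] using norm_sum_le s fun i => WithLp.toLp 2 (f i)

theorem dotProduct_le_norm2_mul_norm2 {n : ℕ} (x y : Fin n → ℝ) :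
    x ⬝ᵥ y ≤ norm2 x * norm2 y := by
  refine le_of_sq_le_sq ?_ (mul_nonneg (norm2_nonneg x) (norm2_nonneg y))
  rw [mul_pow, norm2_sq, norm2_sq]
  simpa [dotProduct, sq] using Finset.sum_mul_sq_le_sq_mul_sq Finset.univ x y

theorem restr_add {n : ℕ} (Λ : Finset (Fin n)) (x y : Fin n → ℝ) :
    restr Λ (x + y) = restr Λ x + restr Λ y := by
  ext i
  by_cases hi : i ∈ Λ <;> simp [restr, hi]

theorem restr_sub_restr_of_disjoint {n : ℕ} {Λ Γ : Finset (Fin n)} (h : Disjoint Γ Λ)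
    (x : Fin n → ℝ) : restr Γ (x - restr Λ x) = restr Γ x := by
  ext i
  by_cases hi : i ∈ Γ
  · simp [restr, hi, Finset.disjoint_left.mp h hi]
  · simp [restr, hi]

theorem support_restr_subset {n : ℕ} (Λ : Finset (Fin n)) (x : Fin n → ℝ) :
    Function.support (restr Λ x) ⊆ ↑Λ := by
  intro i hi
  by_contra h
  exact hi (if_neg h)

theorem restr_dotProduct_restr_of_disjoint {n : ℕ} {Λ Γ : Finset (Fin n)} (h : Disjoint Λ Γ)
    (x y : Fin n → ℝ) : restr Λ x ⬝ᵥ restr Γ y = 0 := by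
  refine Finset.sum_eq_zero fun i _ => ?_
  by_cases hi : i ∈ Λ
  · simp [restr, Finset.disjoint_left.mp h hi]
  · simp [restr, hi]

theorem restr_biUnion {n g : ℕ} {G : Fin g → Finset (Fin n)}
    (hdisj : ∀ i j : Fin g, i ≠ j → Disjoint (G i) (G j)) (S : Finset (Fin g)) (x : Fin n → ℝ) :
    restr (S.biUnion G) x = ∑ j ∈ S, restr (G j) x := by
  classical
  induction S using Finset.induction_on with
  | empty => ext i; simp [restr]
  | insert a S ha ih =>
    rw [Finset.biUnion_insert, Finset.sum_insert ha, ← ih]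
    have hd : Disjoint (G a) (S.biUnion G) :=
      (Finset.disjoint_biUnion_right _ _ _).2 fun j hj =>
        hdisj a j fun h => ha (h ▸ hj)
    ext i
    by_cases hi : i ∈ G a
    · have := Finset.disjoint_left.mp hd hi
      simp only [restr, Finset.mem_union, Pi.add_apply, hi, this]
      simp
    · simp [restr, hi]

theorem eq_restr_biUnion_add_sum_compl {n g : ℕ} {G : Fin g → Finset (Fin n)}
    (hdisj : ∀ i j : Fin g, i ≠ j → Disjoint (G i) (G j))
    (hcover : Finset.univ.biUnion G = (Finset.univ : Finset (Fin n))) (S : Finset (Fin g))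
    (x : Fin n → ℝ) : x = restr (S.biUnion G) x + ∑ j ∈ Sᶜ, restr (G j) x := by
  rw [restr_biUnion hdisj, Finset.sum_add_sum_compl, ← restr_biUnion hdisj, hcover]
  ext i
  simp [restr]

theorem norm2_restr_sq {n : ℕ} (Λ : Finset (Fin n)) (x : Fin n → ℝ) :
    norm2 (restr Λ x) ^ 2 = ∑ i ∈ Λ, x i ^ 2 := by
  rw [norm2_sq, dotProduct]
  simp [restr, sq]

theorem sum_norm2_restr_sq {n g : ℕ} {G : Fin g → Finset (Fin n)}
    (hdisj : ∀ i j : Fin g, i ≠ j → Disjoint (G i) (G j)) (S : Finset (Fin g)) (x : Fin n → ℝ) :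
    ∑ j ∈ S, norm2 (restr (G j) x) ^ 2 = norm2 (restr (S.biUnion G) x) ^ 2 := by
  simp only [norm2_restr_sq]
  exact (Finset.sum_biUnion fun i _ j _ hij => hdisj i j hij).symm

theorem sum_norm2_restr_le_sqrt_card_mul {n g : ℕ} {G : Fin g → Finset (Fin n)}
    (hdisj : ∀ i j : Fin g, i ≠ j → Disjoint (G i) (G j)) (S : Finset (Fin g)) (x : Fin n → ℝ) :
    ∑ j ∈ S, norm2 (restr (G j) x) ≤ √(S.card : ℝ) * norm2 (restr (S.biUnion G) x) := by
  refine le_of_sq_le_sq ?_ (mul_nonneg (Real.sqrt_nonneg _) (norm2_nonneg _))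
  rw [mul_pow, Real.sq_sqrt (Nat.cast_nonneg _), ← sum_norm2_restr_sq hdisj]
  exact sq_sum_le_card_mul_sum_sq

theorem card_le_div_of_card_biUnion_le {n g k lmin : ℕ} {G : Fin g → Finset (Fin n)}
    (hdisj : ∀ i j : Fin g, i ≠ j → Disjoint (G i) (G j)) (hlmin : 0 < lmin)
    (hcard : ∀ i, lmin ≤ (G i).card) {S : Finset (Fin g)} (hS : (S.biUnion G).card ≤ k) :
    S.card ≤ k / lmin := by
  rw [Nat.le_div_iff_mul_le hlmin]
  refine le_trans ?_ hS
  rw [Finset.card_biUnion fun i _ j _ hij => hdisj i j hij]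
  simpa using Finset.card_nsmul_le_sum S (fun j => (G j).card) lmin fun j _ => hcard j

/-- Restrictions to disjoint sets whose union is group sparse have almost orthogonal images. -/
theorem GRIP.abs_dotProduct_le {m n g t : ℕ} {G : Fin g → Finset (Fin n)}
    {A : Matrix (Fin m) (Fin n) ℝ} {δ : ℝ} (hA : GRIP G A t δ) (hδ : 0 ≤ δ)
    {Λ Γ : Finset (Fin n)} (hd : Disjoint Λ Γ) (hs : GkS G t (Λ ∪ Γ)) (x y : Fin n → ℝ) :
    |A.mulVec (restr Λ x) ⬝ᵥ A.mulVec (restr Γ y)| ≤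
      δ * norm2 (restr Λ x) * norm2 (restr Γ y) := by
  set u := restr Λ x
  set v := restr Γ y
  have huv : u ⬝ᵥ v = 0 := restr_dotProduct_restr_of_disjoint hd x y
  have hsupp (c : ℝ) : Function.support (u + c • v) ⊆ ↑(Λ ∪ Γ) := by
    refine (Function.support_add _ _).trans ?_
    rw [Finset.coe_union]
    exact Set.union_subset_union (support_restr_subset Λ x)
      ((Function.support_const_smul_subset c v).trans (support_restr_subset Γ y))
  have hnorm (c : ℝ) : norm2 (u + c • v) ^ 2 = norm2 u ^ 2 + c ^ 2 * norm2 v ^ 2 := by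
    simp only [norm2_sq, add_dotProduct, dotProduct_add, smul_dotProduct, dotProduct_smul,
      smul_eq_mul, dotProduct_comm v u, huv]
    ring
  have himage (c : ℝ) : norm2 (A.mulVec (u + c • v)) ^ 2 = norm2 (A.mulVec u) ^ 2 +
      2 * c * (A.mulVec u ⬝ᵥ A.mulVec v) + c ^ 2 * norm2 (A.mulVec v) ^ 2 := by
    simp only [norm2_sq, Matrix.mulVec_add, Matrix.mulVec_smul, add_dotProduct, dotProduct_add,
      smul_dotProduct, dotProduct_smul, smul_eq_mul,
      dotProduct_comm (A.mulVec v) (A.mulVec u)]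
    ring
  have hdiscrim := discrim_le_zero (a := δ * norm2 v ^ 2)
    (b := 2 * (A.mulVec u ⬝ᵥ A.mulVec v)) (c := δ * norm2 u ^ 2) fun c => by
      have hlow := (hA (u + c • v) ⟨_, hs, hsupp c⟩).1
      have hupp := (hA (u + (-c) • v) ⟨_, hs, hsupp (-c)⟩).2
      rw [hnorm, himage] at hlow hupp
      linarith
  refine abs_le_of_sq_le_sq ?_
    (mul_nonneg (mul_nonneg hδ (norm2_nonneg u)) (norm2_nonneg v))
  rw [discrim] at hdiscrim
  linarith

theorem exists_eq_sInf_of_finite {α : Type*} [Finite α] {p : α → Prop} (hp : ∃ a, p a)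
    (f : α → ℝ) : ∃ a, p a ∧ sInf {t : ℝ | ∃ a, p a ∧ t = f a} = f a := by
  have hfin : {t : ℝ | ∃ a, p a ∧ t = f a}.Finite :=
    (Set.finite_range f).subset fun t ⟨a, _, h⟩ => ⟨a, h.symm⟩
  have hne : {t : ℝ | ∃ a, p a ∧ t = f a}.Nonempty := hp.imp' f fun a ha => ⟨a, ha, rfl⟩
  exact hne.csInf_mem hfin

/-- The cone condition satisfied by the error of a group LASSO minimizer. -/
theorem sum_compl_norm2_restr_le {n g : ℕ} (G : Fin g → Finset (Fin n)) (S : Finset (Fin g))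
    (x h : Fin n → ℝ)
    (hle : ∑ j, norm2 (restr (G j) (x + h)) ≤ ∑ j, norm2 (restr (G j) x)) :
    ∑ j ∈ Sᶜ, norm2 (restr (G j) h) ≤
      ∑ j ∈ S, norm2 (restr (G j) h) + 2 * ∑ j ∈ Sᶜ, norm2 (restr (G j) x) := by
  have hS : ∑ j ∈ S, (norm2 (restr (G j) x) - norm2 (restr (G j) h)) ≤
      ∑ j ∈ S, norm2 (restr (G j) (x + h)) := Finset.sum_le_sum fun j _ => by
    have := norm2_sub_le (restr (G j) x + restr (G j) h) (restr (G j) h)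
    rw [add_sub_cancel_right, ← restr_add] at this
    linarith
  have hSc : ∑ j ∈ Sᶜ, (norm2 (restr (G j) h) - norm2 (restr (G j) x)) ≤
      ∑ j ∈ Sᶜ, norm2 (restr (G j) (x + h)) := Finset.sum_le_sum fun j _ => by
    have := norm2_sub_le (restr (G j) x + restr (G j) h) (restr (G j) x)
    rw [add_sub_cancel_left, ← restr_add] at this
    linarith
  rw [← Finset.sum_add_sum_compl S, ← Finset.sum_add_sum_compl S] at hle
  rw [Finset.sum_sub_distrib] at hS hSc
  linarith

theorem sum_compl_norm2_restr_le_sum_sub {n g : ℕ} {G : Fin g → Finset (Fin n)}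
    (hdisj : ∀ i j : Fin g, i ≠ j → Disjoint (G i) (G j)) (S : Finset (Fin g)) (x : Fin n → ℝ) :
    ∑ j ∈ Sᶜ, norm2 (restr (G j) x) ≤
      ∑ j, norm2 (restr (G j) (x - restr (S.biUnion G) x)) := by
  calc ∑ j ∈ Sᶜ, norm2 (restr (G j) x)
      = ∑ j ∈ Sᶜ, norm2 (restr (G j) (x - restr (S.biUnion G) x)) := by
        refine Finset.sum_congr rfl fun j hj => ?_
        rw [restr_sub_restr_of_disjoint]
        exact (Finset.disjoint_biUnion_right _ _ _).2 fun i hi =>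
          hdisj j i fun h => Finset.mem_compl.mp hj (h ▸ hi)
    _ ≤ _ := Finset.sum_le_univ_sum_of_nonneg fun j => norm2_nonneg _

/-- The restriction of `h` to a group `k`-sparse set is controlled by `A h` and the rest of `h`. -/
theorem GRIP.norm2_restr_le {m n g k : ℕ} {G : Fin g → Finset (Fin n)}
    (hdisj : ∀ i j : Fin g, i ≠ j → Disjoint (G i) (G j))
    (hcover : Finset.univ.biUnion G = (Finset.univ : Finset (Fin n)))
    (hcard : ∀ i, (G i).card ≤ k) {A : Matrix (Fin m) (Fin n) ℝ} {δ : ℝ}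
    (hA : GRIP G A (2 * k) δ) (hδ : 0 ≤ δ) {S : Finset (Fin g)} (hS : (S.biUnion G).card ≤ k)
    (h : Fin n → ℝ) :
    (1 - δ) * norm2 (restr (S.biUnion G) h) ≤
      √(1 + δ) * norm2 (A.mulVec h) + δ * ∑ j ∈ Sᶜ, norm2 (restr (G j) h) := by
  classical
  set Λ := S.biUnion G with hΛ
  set u := restr Λ h with hu
  have hT : 0 ≤ ∑ j ∈ Sᶜ, norm2 (restr (G j) h) := Finset.sum_nonneg fun j _ => norm2_nonneg _
  rcases (norm2_nonneg u).eq_or_lt with h0 | hpos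
  · rw [← h0, mul_zero]
    exact add_nonneg (mul_nonneg (Real.sqrt_nonneg _) (norm2_nonneg _)) (mul_nonneg hδ hT)
  obtain ⟨hlow, hupp⟩ := hA u ⟨Λ, ⟨⟨S, hΛ⟩, by omega⟩, support_restr_subset Λ h⟩
  have hnorm : norm2 (A.mulVec u) ≤ √(1 + δ) * norm2 u := by
    refine le_of_sq_le_sq ?_ (by positivity)
    rwa [mul_pow, Real.sq_sqrt (by positivity)]
  have hsum : A.mulVec u ⬝ᵥ A.mulVec h = norm2 (A.mulVec u) ^ 2 +
      ∑ j ∈ Sᶜ, A.mulVec u ⬝ᵥ A.mulVec (restr (G j) h) := by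
    conv_lhs => rw [eq_restr_biUnion_add_sum_compl hdisj hcover S h]
    rw [← hΛ, ← hu, Matrix.mulVec_add, Matrix.mulVec_sum, dotProduct_add, dotProduct_sum, norm2_sq]
  have hcross : -(δ * norm2 u * ∑ j ∈ Sᶜ, norm2 (restr (G j) h)) ≤
      ∑ j ∈ Sᶜ, A.mulVec u ⬝ᵥ A.mulVec (restr (G j) h) := by
    rw [Finset.mul_sum, ← Finset.sum_neg_distrib]
    refine Finset.sum_le_sum fun j hj => (abs_le.mp (hA.abs_dotProduct_le hδ ?_ ⟨?_, ?_⟩ h h)).1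
    · exact (Finset.disjoint_biUnion_left _ _ _).2 fun i hi =>
        hdisj i j fun e => Finset.mem_compl.mp hj (e ▸ hi)
    · exact ⟨insert j S, by rw [Finset.biUnion_insert, Finset.union_comm]⟩
    · have := Finset.card_union_le Λ (G j)
      have := hcard j
      omega
  have hCS := (dotProduct_le_norm2_mul_norm2 (A.mulVec u) (A.mulVec h)).trans
    (mul_le_mul_of_nonneg_right hnorm (norm2_nonneg _))
  refine le_of_mul_le_mul_right ?_ hpos
  linarith

/-- group LASSO, ℓ₂ bound. -/
theorem stmt13 {m n g k : ℕ} (hk : 0 < k)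
    (G : Fin g → Finset (Fin n))
    -- `G` is a partition of `{1,…,n}` with `l_min ≤ |G_j| ≤ k`
    (hne : ∀ i, (G i).Nonempty)
    (hdisj : ∀ i j : Fin g, i ≠ j → Disjoint (G i) (G j))
    (hcover : Finset.univ.biUnion G = (Finset.univ : Finset (Fin n)))
    (lmin : ℕ) (hlmin : 0 < lmin)
    (hGcard : ∀ i, lmin ≤ (G i).card ∧ (G i).card ≤ k)
    -- `s_max = ⌊k / l_min⌋`
    (smax : ℕ) (hsmax : smax = k / lmin)
    -- the group LASSO norm
    (NGL : (Fin n → ℝ) → ℝ)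
    (hNGL : ∀ z, NGL z = ∑ j, norm2 (restr (G j) z))
    -- `A` satisfies GRIP of order `2k` with constant `δ = δ_{2k} < 1/(1+√(2·s_max))`
    (A : Matrix (Fin m) (Fin n) ℝ)
    (δ : ℝ) (hδ0 : 0 < δ) (hδ : δ < 1 / (1 + Real.sqrt (2 * smax)))
    (hGRIP : GRIP G A (2 * k) δ)
    -- measurements `y = Ax + η`, `‖η‖₂ ≤ ε`
    (x : Fin n → ℝ) (η : Fin m → ℝ) (ε : ℝ) (hε : 0 ≤ ε) (hη : norm2 η ≤ ε)
    (y : Fin m → ℝ) (hy : y = A.mulVec x + η)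
    -- `x̂` minimizes `‖z‖_GL` subject to `‖y − Az‖₂ ≤ ε`
    (xh : Fin n → ℝ)
    (hfeas : norm2 (y - A.mulVec xh) ≤ ε)
    (hopt : ∀ z : Fin n → ℝ, norm2 (y - A.mulVec z) ≤ ε → NGL xh ≤ NGL z)
    -- the group `k`-sparsity index `σ = σ_{k,𝒢}(x, ‖·‖_GL)`
    (σ : ℝ)
    (hσ : σ = sInf {t : ℝ | ∃ Λ : Finset (Fin n), GkS G k Λ ∧ t = NGL (x - restr Λ x)}) :
    norm2 (xh - x)
      ≤ 2 * ((1 + (Real.sqrt 2 - 1) * δ) / (1 - (1 + Real.sqrt (2 * smax)) * δ)) * σ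
        + 2 * (1 + Real.sqrt smax)
          * (Real.sqrt (1 + δ) / (1 - (1 + Real.sqrt (2 * smax)) * δ)) * ε := by
  obtain ⟨Λ, ⟨⟨S, rfl⟩, hSk⟩, hΛ⟩ := exists_eq_sInf_of_finite (p := GkS G k)
    ⟨∅, ⟨∅, by simp⟩, by simp⟩ fun Λ => NGL (x - restr Λ x)
  rw [← hσ] at hΛ
  set h := xh - x with hh
  have hxh : xh = x + h := by rw [hh]; abel
  have hres : y - A.mulVec x = η := by rw [hy, add_sub_cancel_left]
  have hAh : norm2 (A.mulVec h) ≤ 2 * ε := by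
    have := norm2_sub_le (y - A.mulVec x) (y - A.mulVec xh)
    rw [sub_sub_sub_cancel_left, ← Matrix.mulVec_sub, ← hh, hres] at this
    linarith
  have hcone := sum_compl_norm2_restr_le G S x h (by
    simpa only [hNGL, hxh] using hopt x (by rwa [hres]))
  have htail := sum_compl_norm2_restr_le_sum_sub hdisj S x
  rw [← hNGL, ← hΛ] at htail
  set a := norm2 (restr (S.biUnion G) h) with ha
  have ha0 : 0 ≤ a := norm2_nonneg _
  have hhead : ∑ j ∈ S, norm2 (restr (G j) h) ≤ √(smax : ℝ) * a := by
    refine (sum_norm2_restr_le_sqrt_card_mul hdisj S h).trans ?_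
    gcongr
    rw [hsmax]
    exact card_le_div_of_card_biUnion_le hdisj hlmin (fun i => (hGcard i).1) hSk
  have hmain := hGRIP.norm2_restr_le hdisj hcover (fun i => (hGcard i).2) hδ0.le hSk h
  have hsplit : norm2 h ≤ a + ∑ j ∈ Sᶜ, norm2 (restr (G j) h) := by
    conv_lhs => rw [eq_restr_biUnion_add_sum_compl hdisj hcover S h]
    exact (norm2_add_le _ _).trans (by gcongr; exact norm2_sum_le _ _)
  rw [lt_div_iff₀ (by positivity)] at hδ
  rw [Real.sqrt_mul zero_le_two] at hδ ⊢
  set T := ∑ j ∈ Sᶜ, norm2 (restr (G j) h)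
  have hT0 : 0 ≤ T := Finset.sum_nonneg fun j _ => norm2_nonneg _
  set D := 1 - (1 + √2 * √(smax : ℝ)) * δ with hD
  have hDpos : 0 < D := by linarith
  have hT : T ≤ √(smax : ℝ) * a + 2 * σ := by linarith
  have hδT : δ * T ≤ √2 * δ * (√(smax : ℝ) * a + 2 * σ) :=
    mul_le_mul (le_mul_of_one_le_left hδ0.le (Real.one_le_sqrt.2 one_le_two)) hT hT0
      (by positivity)
  have hε' := mul_le_mul_of_nonneg_left hAh (Real.sqrt_nonneg (1 + δ))
  have haD : a * D ≤ 2 * √(1 + δ) * ε + 2 * √2 * δ * σ := by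
    rw [hD]
    linarith
  have hbound : norm2 h * D ≤
      2 * (1 + (√2 - 1) * δ) * σ + 2 * (1 + √(smax : ℝ)) * √(1 + δ) * ε := by
    calc norm2 h * D ≤ ((1 + √(smax : ℝ)) * a + 2 * σ) * D := by gcongr; linarith
      _ = (1 + √(smax : ℝ)) * (a * D) + 2 * σ * D := by ring
      _ ≤ (1 + √(smax : ℝ)) * (2 * √(1 + δ) * ε + 2 * √2 * δ * σ) + 2 * σ * D := by gcongr
      _ = _ := by rw [hD]; ring
  calc norm2 h ≤ (2 * (1 + (√2 - 1) * δ) * σ + 2 * (1 + √(smax : ℝ)) * √(1 + δ) * ε) / D :=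
        (le_div_iff₀ hDpos).2 hbound
    _ = _ := by ring
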